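/- Let $n \ge 2$ and let $x=(x_1,\dots,x_n)$, $y=(y_1,\dots,y_n)$, $w=(w_1,\dots,w_n)$ be three bases of the free group $F_n$. Suppose there exists $v \in F_n$ such that $x_i = v w_i v^{-1}$ for all $i \in \{1,\dots,n\}$. Then $|v|_y \le |w|_y^2 \cdot |y|_x$. -/

import Mathlib

/-- A family `b : Fin n → G` is a free basis of `G` if the induced homomorphism
from the free group on `Fin n` is an isomorphism; this makes `G` a free group
of rank `n` with basis `b`. -/
def IsFreeBasis {n : ℕ} {G : Type*} [Group G] (b : Fin n → G) : Prop :=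
  Function.Bijective (FreeGroup.lift b : FreeGroup (Fin n) →* G)

/-- The word length `|g|_b` of `g` with respect to the basis `b`: the length of the
reduced word (in the letters `b i ^ ±1`) representing `g`, i.e. the smallest length
of the reduced form of an element of the free group mapping to `g` under `b`. -/
noncomputable def wordLength {n : ℕ} {G : Type*} [Group G] (b : Fin n → G) (g : G) : ℕ :=
  sInf {k | ∃ w : FreeGroup (Fin n), FreeGroup.lift b w = g ∧ w.toWord.length = k}

/-- `basisNorm b b' = |b'|_b`, the maximum of the word lengths of the elements of `b'`
with respect to the basis `b`. -/
noncomputable def basisNorm {n : ℕ} {G : Type*} [Group G] (b b' : Fin n → G) : ℕ :=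
  Finset.univ.sup fun i => wordLength b (b' i)

namespace FreeGroup

theorem norm_lift_le {α β : Type*} [DecidableEq α] [DecidableEq β] (f : α → FreeGroup β)
    {m : ℕ} (hf : ∀ a, (f a).norm ≤ m) (u : FreeGroup α) :
    (lift f u).norm ≤ u.norm * m := by
  have key : ∀ L : List (α × Bool), (lift f (mk L)).norm ≤ L.length * m := by
    intro L
    induction L with
    | nil => simp [← one_eq_mk]
    | cons a L ih =>
      have hhead : (lift f (mk [a])).norm ≤ m := by
        obtain ⟨a, _ | _⟩ := a <;> simpa using hf a
      have hmul : (mk (a :: L) : FreeGroup α) = mk [a] * mk L := by simp [mul_mk]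
      rw [hmul, _root_.map_mul, List.length_cons, add_mul, one_mul, add_comm]
      exact (norm_mul_le _ _).trans (add_le_add hhead ih)
  simpa [mk_toWord, norm] using key u.toWord

/-- Conjugating a generator by a reduced word that does not begin with this generator or its
inverse involves no cancellation. -/
theorem norm_inv_mul_of_mul {α : Type*} [DecidableEq α] (V : FreeGroup α) (j : α)
    (hj : ∀ a ∈ V.toWord.head?, a.1 ≠ j) :
    (V⁻¹ * of j * V).norm = 2 * V.norm + 1 := by
  have hred : IsReduced ([(j, true)] ++ V.toWord) :=
    List.isChain_cons.2 ⟨fun a ha h => absurd h.symm (hj a ha), isReduced_toWord⟩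
  have hred' : IsReduced (V⁻¹.toWord ++ [(j, true)]) := by
    refine List.isChain_append.2 ⟨isReduced_toWord, IsReduced.singleton, ?_⟩
    intro a ha b hb hab
    obtain rfl : (j, true) = b := by simpa using hb
    rw [toWord_inv, invRev, List.getLast?_reverse, List.head?_map] at ha
    obtain ⟨c, hc, rfl⟩ := Option.map_eq_some_iff.1 ha
    exact absurd hab (hj c hc)
  have hword : (V⁻¹ * of j * V).toWord = V⁻¹.toWord ++ [(j, true)] ++ V.toWord := by
    rw [← (hred'.append_overlap hred (by simp)).reduce_eq, ← toWord_mk, ← mul_mk, ← mul_mk,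
      mk_toWord, mk_toWord]
    rfl
  have hinv : V⁻¹.toWord.length = V.toWord.length := norm_inv_eq
  simp only [norm, hword, List.length_append, hinv, List.length_singleton]
  ring

end FreeGroup

theorem IsFreeBasis.wordLength_lift {n : ℕ} {G : Type*} [Group G] {b : Fin n → G}
    (hb : IsFreeBasis b) (u : FreeGroup (Fin n)) :
    wordLength b (FreeGroup.lift b u) = u.norm := by
  have hset : {k | ∃ w : FreeGroup (Fin n),
      FreeGroup.lift b w = FreeGroup.lift b u ∧ w.toWord.length = k} = {u.norm} := by
    ext k
    constructor
    · rintro ⟨w, hw, rfl⟩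
      rw [hb.1 hw]
      rfl
    · rintro rfl
      exact ⟨u, rfl, rfl⟩
  rw [wordLength, hset, csInf_singleton]

theorem wordLength_le_basisNorm {n : ℕ} {G : Type*} [Group G] (b b' : Fin n → G) (i : Fin n) :
    wordLength b (b' i) ≤ basisNorm b b' :=
  Finset.le_sup (f := fun i => wordLength b (b' i)) (Finset.mem_univ i)

/-- Lemma 2.3: if $x_i = v w_i v^{-1}$ for three bases $x,y,w$ of $F_n$ ($n ≥ 2$),
then $|v|_y ≤ |w|_y^2 |y|_x$. -/
theorem conjugating_element_length_bound {n : ℕ} (hn : 2 ≤ n) {G : Type*} [Group G]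
    (x y w : Fin n → G) (hx : IsFreeBasis x) (hy : IsFreeBasis y) (hw : IsFreeBasis w)
    (v : G) (hv : ∀ i : Fin n, x i = v * w i * v⁻¹) :
    wordLength y v ≤ (basisNorm y w) ^ 2 * basisNorm x y := by
  obtain ⟨V, rfl⟩ := hy.2 v
  choose W hW using fun i => hy.2 (w i)
  have : Nontrivial (Fin n) := Fin.nontrivial_iff_two_le.2 hn
  obtain ⟨j, hj⟩ : ∃ j, ∀ a ∈ V.toWord.head?, a.1 ≠ j := by
    cases h : V.toWord.head? with
    | none => exact ⟨⟨0, by omega⟩, by simp⟩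
    | some a =>
      obtain ⟨j, hj⟩ := exists_ne a.1
      exact ⟨j, by simpa using hj.symm⟩
  obtain ⟨U, hU⟩ := hx.2 (y j)
  have hconj : FreeGroup.lift x =
      (MulAut.conj (FreeGroup.lift y V)).toMonoidHom.comp
        ((FreeGroup.lift y).comp (FreeGroup.lift W)) := by
    ext i
    simp [hv, hW]
  have heq : V⁻¹ * FreeGroup.of j * V = FreeGroup.lift W U := by
    apply hy.1
    have h := hU
    rw [hconj] at h
    simp only [MonoidHom.comp_apply, MulEquiv.coe_toMonoidHom, MulAut.conj_apply] at h
    rw [map_mul, map_mul, map_inv, FreeGroup.lift_apply_of, ← h]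
    group
  have hWle : ∀ i, (W i).norm ≤ basisNorm y w := fun i => by
    rw [← hy.wordLength_lift, hW]
    exact wordLength_le_basisNorm y w i
  have hUle : U.norm ≤ basisNorm x y := by
    rw [← hx.wordLength_lift, hU]
    exact wordLength_le_basisNorm x y j
  rw [hy.wordLength_lift]
  calc V.norm ≤ 2 * V.norm + 1 := by omega
    _ = (FreeGroup.lift W U).norm := by rw [← heq, FreeGroup.norm_inv_mul_of_mul V j hj]
    _ ≤ U.norm * basisNorm y w := FreeGroup.norm_lift_le W hWle U
    _ ≤ basisNorm x y * basisNorm y w := by gcongr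
    _ = basisNorm y w * basisNorm x y := mul_comm _ _
    _ ≤ basisNorm y w ^ 2 * basisNorm x y := by
      gcongr
      exact Nat.le_self_pow two_ne_zero _
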